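/- arXiv:2005.03265 — 3 statements merged into one kernel-verified Lean document; each statement's English description precedes it below -/
import Mathlib

section
/- Let X be a Banach space, let F : X → ℝ ∪ {+∞} be a proper, lower semicontinuous, convex function, let A : X → ℝⁿ be a continuous linear operator, and suppose b lies in the core of A(dom F). Then inf_{x ∈ X} {F(x) : Ax = b} = max_{φ ∈ ℝⁿ} {⟨φ, b⟩ − F*(A^T φ)}, where the maximum on the right-hand side is attained. -/
open MeasureTheory Set
open scoped ENNReal NNReal

/-- The core of a set `C ⊆ ℝⁿ`: the points `x ∈ C` such that for every direction `η`,
`x + tη ∈ C` for all sufficiently small `t > 0`. -/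
def core {n : ℕ} (C : Set (Fin n → ℝ)) : Set (Fin n → ℝ) :=
  {x ∈ C | ∀ η : Fin n → ℝ, ∃ t₀ > (0 : ℝ), ∀ t : ℝ, 0 < t → t ≤ t₀ → x + t • η ∈ C}

theorem aux_weak (S : EReal) (r : ℝ) (f : EReal) (hf : f ≠ ⊥)
    (h : (r : EReal) - f ≤ S) : (r : EReal) - S ≤ f := by
  induction f using EReal.rec with
  | bot => exact absurd rfl hf
  | top => exact le_top
  | coe f =>
    calc (r : EReal) - S ≤ (r : EReal) - ((r : EReal) - f) := EReal.sub_le_sub le_rfl h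
      _ = f := by norm_cast; ring_nf

theorem aux_strong {X : Type*} [NormedAddCommGroup X] [NormedSpace ℝ X]
    {n : ℕ} (F : X → EReal)
    (hconv : ∀ x y : X, ∀ a b : ℝ, 0 ≤ a → 0 ≤ b → a + b = 1 →
      F (a • x + b • y) ≤ (a : EReal) * F x + (b : EReal) * F y)
    (A : X →L[ℝ] (Fin n → ℝ)) (b : Fin n → ℝ)
    (hb : b ∈ core (A '' {x : X | F x ≠ ⊤})) (m : ℝ)
    (hm : ∀ x, A x = b → (m : EReal) ≤ F x) :
    ∃ φ : Fin n → ℝ, ∀ x (ρ : ℝ), F x ≤ ρ →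
      m + ∑ i, φ i * A x i ≤ ρ + ∑ i, φ i * b i := by
  let s₀ : ConvexCone ℝ ((Fin n → ℝ) × ℝ) :=
    { carrier := {p | ∃ (x : X) (t ρ : ℝ), 0 < t ∧ F x ≤ ρ ∧ p.1 = t • (A x - b) ∧
        p.2 = t * (ρ - m)}
      smul_mem' := by
        rintro c hc p ⟨x, t, ρ, ht, hF, h1, h2⟩
        refine ⟨x, c * t, ρ, mul_pos hc ht, hF, ?_, ?_⟩
        · simp [h1, mul_smul]
        · simp [h2, mul_assoc]
      add_mem' := by
        rintro p ⟨x, t, ρ, ht, hF, h1, h2⟩ q ⟨x', t', ρ', ht', hF', h1', h2'⟩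
        have hT : 0 < t + t' := by positivity
        refine ⟨(t / (t + t')) • x + (t' / (t + t')) • x', t + t',
          (t / (t + t')) * ρ + (t' / (t + t')) * ρ', hT, ?_, ?_, ?_⟩
        · refine (hconv x x' _ _ (by positivity) (by positivity) (by field_simp)).trans ?_
          push_cast
          exact add_le_add
            (mul_le_mul_of_nonneg_left hF (EReal.coe_nonneg.2 (by positivity)))
            (mul_le_mul_of_nonneg_left hF' (EReal.coe_nonneg.2 (by positivity)))
        · ext i
          simp [h1, h1']
          field_simp
          ring
        · simp [h2, h2']
          field_simp
          ring }
  let s : PointedCone ℝ ((Fin n → ℝ) × ℝ) :=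
    { carrier := {p | p = 0 ∨ p ∈ s₀}
      zero_mem' := Or.inl rfl
      add_mem' := by
        rintro p q (rfl | hp) (rfl | hq)
        · left; simp
        · right; simpa using hq
        · right; simpa using hp
        · right; exact s₀.add_mem hp hq
      smul_mem' := by
        rintro ⟨c, hc⟩ p (rfl | hp)
        · left; simp
        · rcases hc.eq_or_lt with rfl | hc'
          · left
            exact zero_smul ℝ p
          · right; exact s₀.smul_mem hc' hp }
  have hne : ((0, 1) : (Fin n → ℝ) × ℝ) ≠ 0 := by simp
  let f : ((Fin n → ℝ) × ℝ) →ₗ.[ℝ] ℝ := LinearPMap.mkSpanSingleton (0, 1) 1 hne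
  have hfd : ∀ r : ℝ, ((0, r) : (Fin n → ℝ) × ℝ) ∈ f.domain := fun r =>
    Submodule.mem_span_singleton.2 ⟨r, by simp⟩
  have hfr : ∀ r : ℝ, f ⟨(0, r), hfd r⟩ = r := by
    intro r
    have h := LinearPMap.mkSpanSingleton'_apply (σ := RingHom.id ℝ) ((0, 1) : (Fin n → ℝ) × ℝ) (1 : ℝ)
      (fun c hc => by
        have h0 : c = 0 := by simpa using hc
        rw [h0]; exact zero_smul ℝ (1 : ℝ)) r (by
          have := hfd r
          simp only [Prod.smul_mk, smul_zero, smul_eq_mul, mul_one]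
          exact this)
    simp only [Prod.smul_mk, smul_zero, smul_eq_mul, mul_one] at h
    exact h
  have hex : ∀ z : f.domain, ∃ r : ℝ, z = ⟨(0, r), hfd r⟩ := by
    rintro ⟨z, hz⟩
    obtain ⟨r, rfl⟩ := Submodule.mem_span_singleton.1 hz
    exact ⟨r, by simp⟩
  obtain ⟨g, hg1, hg2⟩ := riesz_extension s f (by
      intro z hz
      obtain ⟨r, rfl⟩ := hex z
      rw [hfr]
      rcases hz with hz | hz
      · have : r = 0 := congrArg Prod.snd hz
        rw [this]
      obtain ⟨x, t, ρ, ht, hF, h1, h2⟩ := hz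
      have hAx : A x = b := by
        have h1 : (0 : Fin n → ℝ) = t • (A x - b) := h1
        have := (smul_eq_zero.1 h1.symm).resolve_left ht.ne'
        exact sub_eq_zero.1 this
      have : m ≤ ρ := EReal.coe_le_coe_iff.1 ((hm x hAx).trans hF)
      have h2 : r = t * (ρ - m) := h2
      rw [h2]
      exact mul_nonneg ht.le (by linarith)) (by
      rintro ⟨d, ρ⟩
      obtain ⟨t, ht, h⟩ := hb.2 d
      obtain ⟨x, hx, hAx⟩ := h t ht le_rfl
      refine ⟨⟨(0, t⁻¹ * ((F x).toReal - m) - ρ), hfd _⟩, Or.inr ⟨x, t⁻¹, (F x).toReal, inv_pos.2 ht,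
        EReal.le_coe_toReal hx, ?_, ?_⟩⟩
      · simp [hAx, smul_smul, ht.ne']
      · simp)
  have hg0 : g (0, 1) = 1 := (hg1 ⟨(0, 1), hfd 1⟩).trans (hfr 1)
  have hgd : ∀ d : Fin n → ℝ, g (d, 0) = ∑ i, d i * g (Pi.single i 1, 0) := by
    intro d
    have := LinearMap.pi_apply_eq_sum_univ (g.comp (LinearMap.inl ℝ (Fin n → ℝ) ℝ)) d
    simp only [LinearMap.comp_apply, LinearMap.inl_apply, smul_eq_mul] at this
    rw [this]
    refine Finset.sum_congr rfl fun i _ => ?_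
    congr 3
    ext j
    simp [Pi.single_apply, eq_comm]
  refine ⟨fun i => - g (Pi.single i 1, 0), fun x ρ hF => ?_⟩
  have h := hg2 (A x - b, ρ - m) (Or.inr ⟨x, 1, ρ, one_pos, hF, by simp, by simp⟩)
  have e : ((A x - b, ρ - m) : (Fin n → ℝ) × ℝ) = (A x - b, 0) + (ρ - m) • (0, 1) := by simp
  rw [e, map_add, map_smul, hg0, hgd] at h
  simp only [Pi.sub_apply, sub_mul, Finset.sum_sub_distrib, smul_eq_mul, mul_one] at h
  simp only [neg_mul, Finset.sum_neg_distrib, mul_comm (g _)]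
  linarith

/-- **Theorem** (Borwein–Zhu, Theorem 4.7.1). Let `X` be a Banach space,
`F : X → ℝ ∪ {+∞}` a proper lower semicontinuous convex function,
`A : X → ℝⁿ` a continuous linear operator, and `b ∈ core (A (dom F))`. Then
`inf {F(x) : Ax = b} = max_{φ ∈ ℝⁿ} {⟨φ,b⟩ − F*(Aᵀφ)}`, the maximum being attained.
Here `F*(Aᵀφ) = sup_{x ∈ X} (⟨Ax, φ⟩ − F(x))`. -/
theorem stmt_9 {X : Type*} [NormedAddCommGroup X] [NormedSpace ℝ X] [CompleteSpace X]
    {n : ℕ} (F : X → EReal)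
    (hbot : ∀ x : X, F x ≠ ⊥) (hproper : ∃ x : X, F x ≠ ⊤)
    (hlsc : LowerSemicontinuous F)
    (hconv : ∀ x y : X, ∀ a b : ℝ, 0 ≤ a → 0 ≤ b → a + b = 1 →
      F (a • x + b • y) ≤ (a : EReal) * F x + (b : EReal) * F y)
    (A : X →L[ℝ] (Fin n → ℝ)) (b : Fin n → ℝ)
    (hb : b ∈ core (A '' {x : X | F x ≠ ⊤})) :
    ∃ φ : Fin n → ℝ,
      (⨅ x : {x : X // A x = b}, F x.1) =
        ((∑ i, φ i * b i : ℝ) : EReal) -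
          (⨆ x : X, ((∑ i, φ i * A x i : ℝ) : EReal) - F x) ∧
      ∀ ψ : Fin n → ℝ,
        ((∑ i, ψ i * b i : ℝ) : EReal) -
            (⨆ x : X, ((∑ i, ψ i * A x i : ℝ) : EReal) - F x) ≤
          ((∑ i, φ i * b i : ℝ) : EReal) -
            (⨆ x : X, ((∑ i, φ i * A x i : ℝ) : EReal) - F x) := by
  have weak : ∀ ψ : Fin n → ℝ, ((∑ i, ψ i * b i : ℝ) : EReal) -
      (⨆ x : X, ((∑ i, ψ i * A x i : ℝ) : EReal) - F x) ≤ ⨅ x : {x : X // A x = b}, F x.1 := by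
    intro ψ
    refine le_iInf fun ⟨x, hx⟩ => aux_weak _ _ _ (hbot x) ?_
    have := le_iSup (fun x : X => ((∑ i, ψ i * A x i : ℝ) : EReal) - F x) x
    simpa only [hx] using this
  suffices h : ∃ φ : Fin n → ℝ, (⨅ x : {x : X // A x = b}, F x.1) ≤
        ((∑ i, φ i * b i : ℝ) : EReal) -
          (⨆ x : X, ((∑ i, φ i * A x i : ℝ) : EReal) - F x) by
    obtain ⟨φ, h⟩ := h
    exact ⟨φ, le_antisymm h (weak φ), fun ψ => (weak ψ).trans h⟩
  have hle : ∀ x, A x = b → (⨅ x : {x : X // A x = b}, F x.1) ≤ F x := fun x hx =>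
    iInf_le (fun x : {x : X // A x = b} => F x.1) ⟨x, hx⟩
  generalize (⨅ x : {x : X // A x = b}, F x.1) = M at hle
  induction M using EReal.rec with
  | bot => exact ⟨0, bot_le⟩
  | top =>
    obtain ⟨x, hx, hAx⟩ := hb.1
    exact absurd (top_le_iff.1 (hle x hAx)) hx
  | coe m =>
    obtain ⟨φ, hφ⟩ := aux_strong F hconv A b hb m hle
    refine ⟨φ, ?_⟩
    have hS : (⨆ x : X, ((∑ i, φ i * A x i : ℝ) : EReal) - F x) ≤
        ((∑ i, φ i * b i - m : ℝ) : EReal) := by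
      refine iSup_le fun x => ?_
      have hx := hφ x
      have hbx := hbot x
      generalize F x = f at hx hbx
      induction f using EReal.rec with
      | bot => exact absurd rfl hbx
      | top => simp
      | coe f =>
        have := hx f le_rfl
        rw [← EReal.coe_sub, EReal.coe_le_coe_iff]
        linarith
    calc (m : EReal) = ((∑ i, φ i * b i : ℝ) : EReal) - ((∑ i, φ i * b i - m : ℝ) : EReal) := by
          rw [← EReal.coe_sub]; congr 1; ring
      _ ≤ _ := EReal.sub_le_sub le_rfl hS
end

section
/- Let (T, μ) be a σ-finite measure space, let 1 ≤ p < ∞, and let X = L^p(T, μ) with positive cone X₊ = {x ∈ X : x(t) ≥ 0 for almost every t}. Then qri(X₊) = {x ∈ X : x(t) > 0 for almost every t}. -/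
open MeasureTheory Set
open scoped ENNReal NNReal
/-- The quasi-relative interior of a set `C` in a topological vector space:
the points `x ∈ C` such that the closure of the cone `{t(c − x) : t ≥ 0, c ∈ C}`
is a linear subspace. -/
def qri {X : Type*} [AddCommGroup X] [Module ℝ X] [TopologicalSpace X]
    (C : Set X) : Set X :=
  {x ∈ C | ∃ S : Submodule ℝ X,
    closure {y : X | ∃ t : ℝ, 0 ≤ t ∧ ∃ c ∈ C, y = t • (c - x)} = (S : Set X)}

open Filter Topology

lemma aux_dct {T : Type*} [MeasurableSpace T] (μ : Measure T)
    (p : ℝ≥0∞) [Fact (1 ≤ p)] (hp : p ≠ ⊤) (f : ℕ → Lp ℝ p μ) (y : Lp ℝ p μ)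
    (hb : ∀ n, ∀ᵐ t ∂μ, ‖f n t - y t‖ ≤ ‖y t‖)
    (hl : ∀ᵐ t ∂μ, Tendsto (fun n => f n t) atTop (𝓝 (y t))) :
    Tendsto f atTop (𝓝 y) := by
  have hp1 : (1 : ℝ≥0∞) ≤ p := Fact.out
  have hp0 : p ≠ 0 := (lt_of_lt_of_le one_pos hp1).ne'
  have hpr : 0 < p.toReal := ENNReal.toReal_pos hp0 hp
  rw [Lp.tendsto_Lp_iff_tendsto_eLpNorm']
  simp_rw [eLpNorm_eq_lintegral_rpow_enorm_toReal hp0 hp]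
  have key : Tendsto (fun n => ∫⁻ t, ‖(⇑(f n) - ⇑y) t‖ₑ ^ p.toReal ∂μ) atTop
      (𝓝 (∫⁻ _, 0 ∂μ)) := by
    refine tendsto_lintegral_of_dominated_convergence' (fun t => ‖y t‖ₑ ^ p.toReal) ?_ ?_ ?_ ?_
    · intro n
      exact (((Lp.aestronglyMeasurable (f n)).sub (Lp.aestronglyMeasurable y)).enorm).pow_const _
    · intro n
      filter_upwards [hb n] with t ht
      exact ENNReal.rpow_le_rpow (enorm_le_iff_norm_le.2 ht) hpr.le
    · exact (lintegral_rpow_enorm_lt_top_of_eLpNorm_lt_top hp0 hp (Lp.eLpNorm_lt_top y)).ne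
    · filter_upwards [hl] with t ht
      have h1 : Tendsto (fun n => f n t - y t) atTop (𝓝 0) := by
        simpa using ht.sub_const (y t)
      have h2 : Tendsto (fun n => ‖f n t - y t‖ₑ) atTop (𝓝 0) := by
        simpa using h1.enorm
      have := (ENNReal.continuous_rpow_const (y := p.toReal)).tendsto 0 |>.comp h2
      simpa [ENNReal.zero_rpow_of_pos hpr, Function.comp_def] using this
  rw [lintegral_zero] at key
  have := (ENNReal.continuous_rpow_const (y := 1 / p.toReal)).tendsto 0 |>.comp key
  rwa [ENNReal.zero_rpow_of_pos (by positivity)] at this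

/-- **Example** (Borwein–Lewis, Examples 3.11 / `(Q1)`). Let `X = L^p(T,μ)` with
`(T,μ)` σ-finite and `1 ≤ p < ∞`. Then
`qri (X₊) = {x ∈ X : x(t) > 0 a.e.}`. -/
theorem stmt_14 {T : Type*} [MeasurableSpace T] (μ : Measure T) [SigmaFinite μ]
    (p : ℝ≥0∞) [Fact (1 ≤ p)] (hp : p ≠ ⊤) :
    qri {x : Lp ℝ p μ | ∀ᵐ t ∂μ, 0 ≤ x t} =
      {x : Lp ℝ p μ | ∀ᵐ t ∂μ, 0 < x t} := by
  have hp1 : (1 : ℝ≥0∞) ≤ p := Fact.out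
  have hp0 : p ≠ 0 := (lt_of_lt_of_le one_pos hp1).ne'
  ext x
  constructor
  · rintro ⟨hx, S, hS⟩
    by_contra hcon
    have hA : MeasurableSet {t | x t ≤ 0} :=
      measurableSet_le (Lp.stronglyMeasurable x).measurable measurable_const
    have hpos : 0 < μ {t | x t ≤ 0} := by
      rw [pos_iff_ne_zero]
      intro h0
      apply hcon
      change μ _ = 0
      convert h0 using 2
      ext t
      simp
    obtain ⟨B, hB, hBA, hB0, hBt⟩ := Measure.exists_subset_measure_lt_top hA hpos
    set y : Lp ℝ p μ := indicatorConstLp p hB hBt.ne (1 : ℝ) with hy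
    have hyc : y =ᵐ[μ] B.indicator fun _ => (1 : ℝ) := indicatorConstLp_coeFn
    have hny : 0 < ‖y‖ := by
      rw [hy, norm_indicatorConstLp hp0 hp]
      have : 0 < μ.real B := ENNReal.toReal_pos hB0.ne' hBt.ne
      exact mul_pos (by simp) (Real.rpow_pos_of_pos this _)
    have hyS : y ∈ (S : Set (Lp ℝ p μ)) := by
      rw [← hS]
      apply subset_closure
      refine ⟨1, zero_le_one, x + y, ?_, by simp⟩
      change ∀ᵐ t ∂μ, 0 ≤ (x + y : Lp ℝ p μ) t
      filter_upwards [hx, hyc, Lp.coeFn_add x y] with t h1 h2 h3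
      rw [h3, Pi.add_apply, h2]
      exact add_nonneg h1 (indicator_nonneg (fun _ _ => zero_le_one) _)
    have hyS' : -y ∈ (S : Set (Lp ℝ p μ)) := S.neg_mem hyS
    rw [← hS, Metric.mem_closure_iff] at hyS'
    obtain ⟨z, ⟨r, hr, c, hc, rfl⟩, hd⟩ := hyS' _ hny
    rw [dist_comm, dist_eq_norm, sub_neg_eq_add] at hd
    refine absurd hd (not_lt.2 (Lp.norm_le_norm_of_ae_le ?_))
    filter_upwards [hx, hyc, hc, Lp.coeFn_add (r • (c - x)) y, Lp.coeFn_smul r (c - x),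
      Lp.coeFn_sub c x] with t h1 h2 h3 h4 h5 h6
    rw [h4, Pi.add_apply, h5, Pi.smul_apply, h6, Pi.sub_apply, h2]
    by_cases htB : t ∈ B
    · have h7 : x t ≤ 0 := hBA htB
      have h8 : 0 ≤ r * (c t - x t) := mul_nonneg hr (by linarith)
      simp only [indicator_of_mem htB, smul_eq_mul, Real.norm_eq_abs]
      rw [abs_of_nonneg zero_le_one, abs_of_nonneg (by linarith)]
      linarith
    · simp [indicator_of_notMem htB]
      positivity
  · intro hx
    refine ⟨?_, ⊤, ?_⟩
    · change ∀ᵐ t ∂μ, 0 ≤ x t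
      filter_upwards [hx] with t ht using ht.le
    rw [Submodule.top_coe, eq_univ_iff_forall]
    intro y
    let f : ℕ → Lp ℝ p μ := fun n => y ⊔ (-((n : ℝ) + 1)) • x
    have hf : ∀ᵐ t ∂μ, ∀ n, f n t = max (y t) (-((n : ℝ) + 1) * x t) := by
      rw [ae_all_iff]
      intro n
      filter_upwards [Lp.coeFn_sup y ((-((n : ℝ) + 1)) • x),
        Lp.coeFn_smul (-((n : ℝ) + 1)) x] with t h1 h2
      rw [h1, Pi.sup_apply, h2, Pi.smul_apply, smul_eq_mul]
    have hT : Tendsto f atTop (𝓝 y) := by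
      apply aux_dct μ p hp
      · intro n
        filter_upwards [hx, hf] with t h1 h2
        rw [h2]
        have : 0 < ((n : ℝ) + 1) * x t := by positivity
        rcases max_cases (y t) (-((n : ℝ) + 1) * x t) with h | h <;> rw [h.1]
        · simp
        · rw [Real.norm_eq_abs, Real.norm_eq_abs, abs_of_nonneg (by linarith),
            abs_of_nonpos (by linarith)]
          linarith
      · filter_upwards [hx, hf] with t h1 h2
        apply tendsto_const_nhds.congr'
        obtain ⟨N, hN⟩ := exists_nat_ge (- y t / x t)
        filter_upwards [eventually_ge_atTop N] with n hn
        rw [h2, eq_comm, max_eq_left]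
        rw [div_le_iff₀ h1] at hN
        have : (N : ℝ) ≤ n := by exact_mod_cast hn
        nlinarith
    refine mem_closure_of_tendsto hT (Eventually.of_forall fun n => ?_)
    have hn : (0 : ℝ) < (n : ℝ) + 1 := by positivity
    refine ⟨(n : ℝ) + 1, hn.le, x + ((n : ℝ) + 1)⁻¹ • f n, ?_, ?_⟩
    · change ∀ᵐ t ∂μ, 0 ≤ (x + ((n : ℝ) + 1)⁻¹ • f n : Lp ℝ p μ) t
      filter_upwards [hf, Lp.coeFn_add x (((n : ℝ) + 1)⁻¹ • f n),
        Lp.coeFn_smul ((n : ℝ) + 1)⁻¹ (f n)] with t h1 h2 h3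
      rw [h2, Pi.add_apply, h3, Pi.smul_apply, h1, smul_eq_mul]
      have h4 := mul_le_mul_of_nonneg_left (le_max_right (y t) (-((n : ℝ) + 1) * x t))
        (inv_pos.2 hn).le
      have h5 : ((n : ℝ) + 1)⁻¹ * (-((n : ℝ) + 1) * x t) = - x t := by field_simp
      linarith
    · rw [add_sub_cancel_left, smul_smul, mul_inv_cancel₀ hn.ne', one_smul]
end

section
/- Let (T, μ) be a σ-finite measure space, let 1 ≤ p < ∞, let X = L^p(T, μ), and let α < β be real numbers. Define X_{≥α} = {x ∈ X : x(t) ≥ α a.e.} and X_{≤β} = {x ∈ X : x(t) ≤ β a.e.}. Then qri X_{≥α} = {x ∈ X : x(t) > α a.e.}, qri X_{≤β} = {x ∈ X : x(t) < β a.e.}, and consequently qri X_{≥α} ∩ qri X_{≤β} = {x ∈ X : α < x(t) < β a.e.}. -/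
open MeasureTheory Set
open scoped ENNReal NNReal

lemma qri_neg_aux {X : Type*} [AddCommGroup X] [Module ℝ X] [TopologicalSpace X]
    [ContinuousNeg X] (C D : Set X) (h : ∀ c, c ∈ D ↔ -c ∈ C) (x : X) (hx : -x ∈ qri C) :
    x ∈ qri D := by
  obtain ⟨h1, S, hS⟩ := hx
  refine ⟨(h x).2 h1, S, ?_⟩
  have e : {y : X | ∃ t : ℝ, 0 ≤ t ∧ ∃ c ∈ D, y = t • (c - x)} =
      (Neg.neg) ⁻¹' {y : X | ∃ t : ℝ, 0 ≤ t ∧ ∃ c ∈ C, y = t • (c - (-x))} := by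
    ext y
    constructor
    · rintro ⟨t, ht, c, hc, rfl⟩
      exact ⟨t, ht, -c, (h c).1 hc, by module⟩
    · rintro ⟨t, ht, c, hc, hy⟩
      refine ⟨t, ht, -c, (h _).2 (by simpa using hc), ?_⟩
      rw [← neg_neg y, hy]; module
  have := (Homeomorph.neg X).preimage_closure {y : X | ∃ t : ℝ, 0 ≤ t ∧ ∃ c ∈ C, y = t • (c - (-x))}
  rw [hS] at this
  rw [e]
  refine Eq.trans this.symm ?_
  ext z
  simp

lemma qri_ge_aux {T : Type*} [MeasurableSpace T] (μ : Measure T) [SigmaFinite μ]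
    (p : ℝ≥0∞) [Fact (1 ≤ p)] (hp : p ≠ ⊤) (α : ℝ) :
    qri {x : Lp ℝ p μ | ∀ᵐ t ∂μ, α ≤ x t} = {x : Lp ℝ p μ | ∀ᵐ t ∂μ, α < x t} := by
  have hp0 : p ≠ 0 := (lt_of_lt_of_le zero_lt_one (Fact.out : 1 ≤ p)).ne'
  ext x
  constructor
  · rintro ⟨hx, S, hS⟩
    simp only [mem_ofPred_eq] at hx ⊢
    by_contra hcon
    have hA : MeasurableSet {t | x t ≤ α} :=
      measurableSet_le (Lp.stronglyMeasurable x).measurable measurable_const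
    have hpos : 0 < μ {t | x t ≤ α} := by
      rw [pos_iff_ne_zero]
      intro h0
      apply hcon
      rw [ae_iff]
      simpa using h0
    obtain ⟨B, hB, hBA, hB0, hBt⟩ := Measure.exists_subset_measure_lt_top hA hpos
    set b : Lp ℝ p μ := indicatorConstLp p hB hBt.ne (1 : ℝ) with hb
    have hbc : b =ᵐ[μ] B.indicator fun _ => (1 : ℝ) := indicatorConstLp_coeFn
    have hbn : 0 < ‖b‖ := by
      rw [hb, norm_indicatorConstLp hp0 hp]
      have : 0 < μ.real B := ENNReal.toReal_pos hB0.ne' hBt.ne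
      simp only [norm_one, one_mul]
      positivity
    have hbS : b ∈ (S : Set (Lp ℝ p μ)) := by
      rw [← hS]
      apply subset_closure
      refine ⟨1, zero_le_one, x + b, ?_, by simp⟩
      filter_upwards [hx, hbc, Lp.coeFn_add x b] with t h1 h2 h3
      rw [h3, Pi.add_apply, h2]
      have : 0 ≤ B.indicator (fun _ => (1 : ℝ)) t := indicator_nonneg (fun _ _ => zero_le_one) _
      linarith
    have hnb : -b ∈ (S : Set (Lp ℝ p μ)) := S.neg_mem hbS
    rw [← hS, Metric.mem_closure_iff] at hnb
    obtain ⟨y, ⟨s, hs, c, hc, rfl⟩, hd⟩ := hnb _ hbn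
    rw [dist_comm, dist_eq_norm, sub_neg_eq_add] at hd
    refine absurd (Lp.norm_le_norm_of_ae_le (f := b) ?_) (not_le.2 hd)
    filter_upwards [hc, hbc, Lp.coeFn_add (s • (c - x)) b, Lp.coeFn_smul s (c - x),
      Lp.coeFn_sub c x] with t h1 h2 h3 h4 h5
    rw [h3, Pi.add_apply, h4, Pi.smul_apply, h5, Pi.sub_apply, h2]
    by_cases ht : t ∈ B
    · have h6 : x t ≤ α := hBA ht
      simp only [indicator_of_mem ht, smul_eq_mul, Real.norm_eq_abs]
      have : 0 ≤ s * (c t - x t) := mul_nonneg hs (by linarith)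
      rw [abs_of_nonneg zero_le_one, abs_of_nonneg (by linarith)]
      linarith
    · simp [indicator_of_notMem ht]
      positivity
  · intro hx
    simp only [mem_ofPred_eq] at hx
    refine ⟨hx.mono fun t h => h.le, ⊤, ?_⟩
    rw [Submodule.top_coe, eq_univ_iff_forall]
    intro y
    set g : ℕ → T → ℝ := fun n t => max 0 (((n : ℝ) + 1) * (α - x t) - y t) with hg
    have hgm : ∀ n, AEStronglyMeasurable (g n) μ := by
      intro n
      have h1 := (Lp.stronglyMeasurable x).measurable
      have h2 := (Lp.stronglyMeasurable y).measurable
      have : Measurable (g n) := by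
        simp only [hg]
        fun_prop
      exact this.aestronglyMeasurable
    have hgb : ∀ n, ∀ᵐ t ∂μ, ‖g n t‖ ≤ ‖y t‖ := by
      intro n
      filter_upwards [hx] with t ht
      rw [Real.norm_eq_abs, Real.norm_eq_abs, abs_of_nonneg (le_max_left _ _)]
      refine max_le (abs_nonneg _) ?_
      have : ((n : ℝ) + 1) * (α - x t) ≤ 0 :=
        mul_nonpos_of_nonneg_of_nonpos (by positivity) (by linarith)
      have := neg_abs_le (y t)
      linarith
    have hgL : ∀ n, MemLp (g n) p μ := fun n => (Lp.memLp y).of_le (hgm n) (hgb n)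
    have hlim : Filter.Tendsto (fun n => eLpNorm (g n) p μ) Filter.atTop (nhds 0) := by
      have hpr : 0 < p.toReal := ENNReal.toReal_pos hp0 hp
      simp only [eLpNorm_eq_lintegral_rpow_enorm_toReal hp0 hp]
      have key : Filter.Tendsto (fun n => ∫⁻ t, ‖g n t‖ₑ ^ p.toReal ∂μ) Filter.atTop
          (nhds (∫⁻ _, 0 ∂μ)) := by
        refine tendsto_lintegral_of_dominated_convergence' (fun t => ‖y t‖ₑ ^ p.toReal)
          (fun n => (hgm n).enorm.pow_const _) (fun n => ?_) ?_ ?_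
        · filter_upwards [hgb n] with t ht
          gcongr
          exact enorm_le_iff_norm_le.2 ht
        · exact (lintegral_rpow_enorm_lt_top_of_eLpNorm_lt_top hp0 hp (Lp.memLp y).2).ne
        · filter_upwards [hx] with t ht
          apply tendsto_const_nhds.congr'
          obtain ⟨N, hN⟩ := exists_nat_gt (-y t / (x t - α))
          filter_upwards [Filter.eventually_ge_atTop N] with n hn
          have h1 : 0 < x t - α := by linarith
          rw [div_lt_iff₀ h1] at hN
          have h2 : (N : ℝ) ≤ n := by exact_mod_cast hn
          have h3 : (N : ℝ) * (x t - α) ≤ n * (x t - α) := by gcongr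
          have : g n t = 0 := max_eq_left (by nlinarith)
          simp [this, hpr]
      rw [lintegral_zero] at key
      have := (ENNReal.continuous_rpow_const (y := 1 / p.toReal)).tendsto 0 |>.comp key
      rw [ENNReal.zero_rpow_of_pos (by positivity)] at this
      exact this
    have hlim' : Filter.Tendsto (fun n => y + (hgL n).toLp (g n)) Filter.atTop (nhds y) := by
      have h0 : Filter.Tendsto (fun n => (hgL n).toLp (g n)) Filter.atTop (nhds 0) := by
        rw [tendsto_zero_iff_norm_tendsto_zero]
        simp only [Lp.norm_toLp]
        exact (ENNReal.tendsto_toReal ENNReal.zero_ne_top).comp hlim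
      simpa using h0.const_add y
    refine mem_closure_of_tendsto hlim' (Filter.Eventually.of_forall fun n => ?_)
    have hn : (0 : ℝ) < (n : ℝ) + 1 := by positivity
    refine ⟨(n : ℝ) + 1, hn.le,
      x + ((n : ℝ) + 1)⁻¹ • (y + (hgL n).toLp (g n)), ?_, ?_⟩
    · filter_upwards [Lp.coeFn_add x (((n : ℝ) + 1)⁻¹ • (y + (hgL n).toLp (g n))),
        Lp.coeFn_smul ((n : ℝ) + 1)⁻¹ (y + (hgL n).toLp (g n)),
        Lp.coeFn_add y ((hgL n).toLp (g n)), (hgL n).coeFn_toLp] with t h1 h2 h3 h4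
      rw [h1, Pi.add_apply, h2, Pi.smul_apply, h3, Pi.add_apply, h4, smul_eq_mul]
      have h5 : ((n : ℝ) + 1) * (α - x t) - y t ≤ g n t := le_max_right _ _
      have h6 : α - x t ≤ ((n : ℝ) + 1)⁻¹ * (y t + g n t) := by
        rw [inv_mul_eq_div, le_div_iff₀ hn]
        linarith
      linarith
    · rw [add_sub_cancel_left, smul_smul, mul_inv_cancel₀ hn.ne', one_smul]

/-- **Equations** `\eqref{suitabletranslation}` and `\eqref{qricap}`. Let
`X = L^p(T,μ)` with `(T,μ)` σ-finite, `1 ≤ p < ∞`, and `α < β`. Then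
`qri X_{≥α} = {x : x(t) > α a.e.}`, `qri X_{≤β} = {x : x(t) < β a.e.}`, and
`qri X_{≥α} ∩ qri X_{≤β} = {x : α < x(t) < β a.e.}`. -/
theorem stmt_15 {T : Type*} [MeasurableSpace T] (μ : Measure T) [SigmaFinite μ]
    (p : ℝ≥0∞) [Fact (1 ≤ p)] (hp : p ≠ ⊤)
    (α β : ℝ) (hαβ : α < β) :
    qri {x : Lp ℝ p μ | ∀ᵐ t ∂μ, α ≤ x t} = {x : Lp ℝ p μ | ∀ᵐ t ∂μ, α < x t} ∧
    qri {x : Lp ℝ p μ | ∀ᵐ t ∂μ, x t ≤ β} = {x : Lp ℝ p μ | ∀ᵐ t ∂μ, x t < β} ∧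
    qri {x : Lp ℝ p μ | ∀ᵐ t ∂μ, α ≤ x t} ∩ qri {x : Lp ℝ p μ | ∀ᵐ t ∂μ, x t ≤ β} =
      {x : Lp ℝ p μ | ∀ᵐ t ∂μ, α < x t ∧ x t < β} := by
  have h1 := qri_ge_aux μ p hp α
  have h2 : qri {x : Lp ℝ p μ | ∀ᵐ t ∂μ, x t ≤ β} = {x : Lp ℝ p μ | ∀ᵐ t ∂μ, x t < β} := by
    have h3 := qri_ge_aux μ p hp (-β)
    have hD : ∀ c : Lp ℝ p μ, c ∈ {x : Lp ℝ p μ | ∀ᵐ t ∂μ, x t ≤ β} ↔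
        -c ∈ {x : Lp ℝ p μ | ∀ᵐ t ∂μ, -β ≤ x t} := by
      intro c
      rw [mem_ofPred_eq, mem_ofPred_eq]
      refine Filter.eventually_congr ?_
      filter_upwards [Lp.coeFn_neg c] with t ht
      rw [ht, Pi.neg_apply, neg_le_neg_iff]
    have hE : ∀ c : Lp ℝ p μ, c ∈ {x : Lp ℝ p μ | ∀ᵐ t ∂μ, x t < β} ↔
        -c ∈ {x : Lp ℝ p μ | ∀ᵐ t ∂μ, -β < x t} := by
      intro c
      rw [mem_ofPred_eq, mem_ofPred_eq]
      refine Filter.eventually_congr ?_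
      filter_upwards [Lp.coeFn_neg c] with t ht
      rw [ht, Pi.neg_apply, neg_lt_neg_iff]
    ext x
    rw [hE, ← h3]
    constructor
    · intro hx
      refine qri_neg_aux _ _ (fun c => ?_) (-x) (by rwa [neg_neg])
      rw [hD, neg_neg]
    · exact qri_neg_aux _ _ hD x
  refine ⟨h1, h2, ?_⟩
  rw [h1, h2]
  ext x
  simp only [mem_inter_iff, mem_ofPred_eq, Filter.eventually_and]
end
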